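/- arXiv:1705.04205 — 3 statements merged into one kernel-verified Lean document; each statement's English description precedes it below -/
import Mathlib

section
/- There exist absolute constants ε₀ > 0 and N₀ such that the following holds. Let k ≥ 2 be an even integer, s an integer with s ≥ k, r = s/k, and let n, n_R be positive integers with k²·n = 625·s²·n_R, n_L = n − n_R, N₀·s ≤ √n_R, and n ≥ N₀. Let f be the hard function built from any balanced-blocks function on (Fin n_R → Bool) with 3s blocks. Then every s-monotone function g : (Fin n → Bool) → Bool satisfies d(f, g) ≥ ε₀. -/
/-- A point of the hypercube `{0,1}^n`. -/
abbrev Pt (n : ℕ) := Fin n → Bool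

/-- The weight `|x|` of a point: the number of coordinates set to `true`. -/
def wt {n : ℕ} (x : Pt n) : ℕ := (Finset.univ.filter (fun i => x i = true)).card

/-- The partial order `x ≼ y` on the hypercube. -/
def ple {n : ℕ} (x y : Pt n) : Prop := ∀ i, x i ≤ y i

/-- The strict order `x ≺ y` on the hypercube. -/
def plt {n : ℕ} (x y : Pt n) : Prop := ple x y ∧ x ≠ y

/-- `f` is `k`-monotone: there is no chain `x 0 ≺ x 1 ≺ ⋯ ≺ x k` with
`f (x 0) = true` and `f` alternating along the chain. -/
def IsKMono {n : ℕ} (k : ℕ) (f : Pt n → Bool) : Prop :=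
  ¬ ∃ x : ℕ → Pt n, (∀ i < k, plt (x i) (x (i + 1))) ∧ f (x 0) = true ∧
      ∀ i < k, f (x i) ≠ f (x (i + 1))

/-- The normalized Hamming distance `d(f,g)`. -/
noncomputable def hdist {n : ℕ} (f g : Pt n → Bool) : ℝ :=
  ({x : Pt n | f x ≠ g x}.ncard : ℝ) / 2 ^ n

/-- `b : ℕ → ℕ` describes a balanced-blocks partition of `{0,1}^m` into `ℓ` blocks:
the `i`-th interval of levels (0-indexed) is `I_{i+1} = [b i, b (i+1))`, these intervals
are nonempty and partition `{0,…,m}`, and each block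
`B_{i+1} = {y : b i ≤ |y| < b (i+1)}` has size within a `(1 ± ℓ/√m)` factor of `2^m/ℓ`. -/
def IsBBPartition (m ℓ : ℕ) (b : ℕ → ℕ) : Prop :=
  b 0 = 0 ∧ b ℓ = m + 1 ∧ (∀ i < ℓ, b i < b (i + 1)) ∧
  ∀ i < ℓ,
    (1 - ℓ / Real.sqrt m) * 2 ^ m / ℓ ≤
        ({y : Pt m | b i ≤ wt y ∧ wt y < b (i + 1)}.ncard : ℝ) ∧
    ({y : Pt m | b i ≤ wt y ∧ wt y < b (i + 1)}.ncard : ℝ) ≤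
        (1 + ℓ / Real.sqrt m) * 2 ^ m / ℓ

/-- `BB` is the balanced-blocks function associated to the partition `b`:
it is `true` exactly on the blocks `B_i` with `i` odd (1-indexed), i.e. those whose
0-indexed position is even. -/
def IsBBFun (m ℓ : ℕ) (b : ℕ → ℕ) (BB : Pt m → Bool) : Prop :=
  ∀ y : Pt m, BB y = true ↔ ∃ i < ℓ, Even i ∧ b i ≤ wt y ∧ wt y < b (i + 1)

/-- The weight `w` belongs to `MID_L`, i.e. `|w - n_L/2| ≤ √n_L/100`. -/
def midL (nL w : ℕ) : Prop := |(w : ℝ) - nL / 2| ≤ Real.sqrt nL / 100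

/-- The weight of `z` restricted to the first `nL` coordinates (the set `L`). -/
def wL {n : ℕ} (nL : ℕ) (z : Pt n) : ℕ :=
  (Finset.univ.filter (fun i : Fin n => (i : ℕ) < nL ∧ z i = true)).card

/-- The weight of `z` restricted to the coordinates of index `≥ nL` (the set `R`). -/
def wR {n : ℕ} (nL : ℕ) (z : Pt n) : ℕ :=
  (Finset.univ.filter (fun i : Fin n => nL ≤ (i : ℕ) ∧ z i = true)).card

/-- The restriction of `z : Pt n` to the last `nR` coordinates, given `nL + nR = n`. -/
def yPart {n : ℕ} (nL nR : ℕ) (h : nL + nR = n) (z : Pt n) : Pt nR :=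
  fun j => z ⟨nL + (j : ℕ), by have hj := j.isLt; omega⟩

/-- `f` is the hard function built from `BB : Pt nR → Bool`: writing `z = (x,y)` with
`x` the first `nL` coordinates and `y` the last `nR` coordinates, `f z = BB y` when
`|x| ∈ MID_L`, and `f z = false` otherwise. -/
def IsHardFun {n : ℕ} (nL nR : ℕ) (h : nL + nR = n) (BB : Pt nR → Bool)
    (f : Pt n → Bool) : Prop :=
  ∀ z : Pt n,
    (midL nL (wL nL z) → f z = BB (yPart nL nR h z)) ∧
    (¬ midL nL (wL nL z) → f z = false)

/-- The maximal chain generated by a permutation `σ`: `z_i(j) = decide (σ⁻¹ j < i)`. -/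
def chainOf {n : ℕ} (σ : Equiv.Perm (Fin n)) : ℕ → Pt n :=
  fun i j => decide ((σ.symm j : ℕ) < i)

/-- `Z 0 ≺ Z 1 ≺ ⋯ ≺ Z n` is a maximal chain in `{0,1}^n`
(so `Z 0 = 0ⁿ`, `Z n = 1ⁿ` and `|Z i| = i`). -/
def IsFullChain {n : ℕ} (Z : ℕ → Pt n) : Prop :=
  (∀ i < n, plt (Z i) (Z (i + 1))) ∧ ∀ i ≤ n, wt (Z i) = i

/-- The chain `Z 0 ≺ ⋯ ≺ Z n` contains a violation of `k`-monotonicity of `f`: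
some `k+1` of its points form such a violation. -/
def ChainViol {n : ℕ} (k : ℕ) (f : Pt n → Bool) (Z : ℕ → Pt n) : Prop :=
  ∃ t : ℕ → ℕ, (∀ i < k, t i < t (i + 1)) ∧ (∀ i ≤ k, t i ≤ n) ∧
    f (Z (t 0)) = true ∧ ∀ i < k, f (Z (t i)) ≠ f (Z (t (i + 1)))

/-- The probability, over a uniformly random permutation `σ` of `Fin n`
(equivalently, a uniformly random maximal chain `chainOf σ`), of the event `P`. -/
noncomputable def permProb (n : ℕ) (P : Equiv.Perm (Fin n) → Prop) : ℝ :=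
  ({σ : Equiv.Perm (Fin n) | P σ}.ncard : ℝ) / Nat.factorial n

/-- The set `V(Z)`: all `j` such that some point `z = (x,y)` on the chain `Z`
has `|x| ∈ MID_L` and `|y| = j`. -/
def VSet {n : ℕ} (nL : ℕ) (Z : ℕ → Pt n) : Set ℕ :=
  {j | ∃ i ≤ n, midL nL (wL nL (Z i)) ∧ wR nL (Z i) = j}

open Finset

lemma card_wt_eq (m i : ℕ) : #{y : Pt m | wt y = i} = m.choose i := by
  have h : m.choose i = #(powersetCard i (univ : Finset (Fin m))) := by simp
  rw [h]
  refine Finset.card_bij (fun y _ => univ.filter (fun j => y j = true)) ?_ ?_ ?_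
  · intro y hy
    exact mem_powersetCard.2 ⟨subset_univ _, (mem_filter.1 hy).2⟩
  · intro y _ y' _ h
    funext j
    have := Finset.ext_iff.1 h j
    rw [Bool.eq_iff_iff]
    simpa only [mem_filter, mem_univ, true_and] using this
  · intro s hs
    refine ⟨fun j => decide (j ∈ s), ?_, ?_⟩
    · refine mem_filter.2 ⟨mem_univ _, ?_⟩
      simpa [wt] using (mem_powersetCard.1 hs).2
    · ext j
      simp

/-- The maximal chain of the hypercube which switches coordinates on in the order `σ`. -/
def numChain {m : ℕ} (σ : Numbering (Fin m)) (i : ℕ) : Pt m := fun j => decide ((σ j : ℕ) < i)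

lemma wt_numChain {m : ℕ} (σ : Numbering (Fin m)) {i : ℕ} (hi : i ≤ m) :
    wt (numChain σ i) = i := by
  have h : (univ.filter (fun j => numChain σ i j = true)).map σ.toEmbedding
      = univ.filter (fun a : Fin (Fintype.card (Fin m)) => (a : ℕ) < i) := by
    ext a
    simp only [numChain, mem_map, mem_filter, mem_univ, true_and, decide_eq_true_eq,
      Equiv.coe_toEmbedding]
    constructor
    · rintro ⟨j, hj, rfl⟩
      exact hj
    · intro ha
      exact ⟨σ.symm a, by simpa using ha, by simp⟩
  rw [wt, ← card_map σ.toEmbedding, h, Fin.card_filter_val_lt]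
  simpa using hi

lemma plt_numChain {m : ℕ} (σ : Numbering (Fin m)) {i j : ℕ} (hij : i < j) (hj : j ≤ m) :
    plt (numChain σ i) (numChain σ j) := by
  refine ⟨fun a => ?_, fun h => ?_⟩
  · simp only [numChain]
    intro h
    simp only [decide_eq_true_eq] at h ⊢
    omega
  · have := congrArg wt h
    rw [wt_numChain σ (by omega), wt_numChain σ hj] at this
    omega

lemma wt_le {m : ℕ} (y : Pt m) : wt y ≤ m := by
  simpa [wt] using card_filter_le (univ : Finset (Fin m)) (fun i => y i = true)

lemma numChain_wt_eq_iff {m : ℕ} (σ : Numbering (Fin m)) (y y' : Pt m) :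
    numChain σ (wt y) = y' ↔
      wt y = wt y' ∧ σ.IsPrefix (univ.filter (fun j => y' j = true)) := by
  constructor
  · rintro rfl
    refine ⟨(wt_numChain σ (wt_le y)).symm, fun j => ?_⟩
    change _ ↔ _ < wt (numChain σ (wt y))
    rw [wt_numChain σ (wt_le y)]
    simp [numChain]
  · rintro ⟨h, hp⟩
    funext j
    have := hp j
    change _ ↔ _ < wt y' at this
    rw [Bool.eq_iff_iff, numChain, h, decide_eq_true_eq, ← this]
    simp

/-- A uniformly random level of a uniformly random maximal chain, the level being that of a
uniformly random point, is a uniformly random point. -/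
lemma sum_card_numChain {m : ℕ} (p : Pt m → Prop) [DecidablePred p] :
    ∑ σ : Numbering (Fin m), #{y : Pt m | p (numChain σ (wt y))}
      = m.factorial * #{y : Pt m | p y} := by
  have h1 : ∀ σ : Numbering (Fin m), #{y : Pt m | p (numChain σ (wt y))}
      = ∑ y' : Pt m with p y', #{y : Pt m | numChain σ (wt y) = y'} := by
    intro σ
    rw [card_eq_sum_card_fiberwise (f := fun y => numChain σ (wt y))
      (t := univ.filter (fun y' : Pt m => p y'))]
    · refine sum_congr rfl fun y' hy' => ?_
      congr 1
      ext y
      simp only [mem_filter, mem_univ, true_and] at hy' ⊢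
      constructor
      · exact fun h => h.2
      · exact fun h => ⟨h ▸ hy', h⟩
    · intro y hy
      simpa using hy
  simp_rw [h1]
  rw [sum_comm, mul_comm, ← smul_eq_mul, ← sum_const]
  refine sum_congr rfl fun y' _ => ?_
  simp_rw [card_filter, numChain_wt_eq_iff]
  rw [sum_comm]
  have h2 : ∀ y : Pt m, (∑ σ : Numbering (Fin m),
      if wt y = wt y' ∧ σ.IsPrefix (univ.filter (fun j => y' j = true)) then 1 else 0)
      = if wt y = wt y' then (wt y').factorial * (m - wt y').factorial else 0 := by
    intro y
    by_cases h : wt y = wt y'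
    · have := Numbering.card_prefixed (univ.filter (fun j => y' j = true))
      rw [Numbering.prefixed, card_filter] at this
      simp only [h, true_and, if_true]
      refine this.trans ?_
      rw [Fintype.card_fin, wt]
    · simp [h]
  simp_rw [h2]
  rw [← sum_filter, sum_const, card_wt_eq, smul_eq_mul, ← mul_assoc,
    Nat.choose_mul_factorial_mul_factorial (wt_le y')]

/-- Interleaving the positions `a q < c q`, `q ∈ S`, gives a long increasing sequence. -/
lemma exists_interleaving {s : ℕ} {S : Finset ℕ} (hS : s < 2 * #S) {a c : ℕ → ℕ}
    (hac : ∀ q ∈ S, a q < c q) (hca : ∀ q ∈ S, ∀ q' ∈ S, q < q' → c q < a q') :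
    ∃ t : ℕ → ℕ, (∀ i < s, t i < t (i + 1)) ∧
      (∀ i ≤ s, Even i → ∃ q ∈ S, t i = a q) ∧ ∀ i ≤ s, ¬ Even i → ∃ q ∈ S, t i = c q := by
  have hfin : ∀ hf : (Set.ofPred (· ∈ S)).Finite, #hf.toFinset = #S := by
    intro hf
    congr 1
    ext q
    simp
  let e := Nat.nth (· ∈ S)
  have hmem : ∀ i < #S, e i ∈ S := fun i hi => Nat.nth_mem i fun hf => by rwa [hfin hf]
  have hlt : ∀ i j, i < j → j < #S → e i < e j := fun i j hij hj =>
    Nat.nth_lt_nth' hij fun hf => by rwa [hfin hf]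
  refine ⟨fun i => if Even i then a (e (i / 2)) else c (e (i / 2)), ?_, ?_, ?_⟩
  · intro i hi
    by_cases h : Even i
    · have h' : ¬ Even (i + 1) := by grind
      have h2 : (i + 1) / 2 = i / 2 := by grind
      simp only [h, h', if_true, if_false, h2]
      exact hac _ (hmem _ (by omega))
    · have h' : Even (i + 1) := by grind
      have h2 : (i + 1) / 2 = i / 2 + 1 := by grind
      simp only [h, h', if_true, if_false, h2]
      exact hca _ (hmem _ (by omega)) _ (hmem _ (by omega)) (hlt _ _ (by omega) (by omega))
  · intro i hi h
    exact ⟨_, hmem (i / 2) (by omega), by simp [h]⟩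
  · intro i hi h
    exact ⟨_, hmem (i / 2) (by omega), by simp [h]⟩

/-- The endpoints of a partition into intervals are monotone. -/
lemma IsBBPartition.mono {m l : ℕ} {b : ℕ → ℕ} (hb : IsBBPartition m l b) {p q : ℕ}
    (hpq : p ≤ q) (hq : q ≤ l) : b p ≤ b q := by
  induction q, hpq using Nat.le_induction with
  | base => rfl
  | succ q _ ih => exact (ih (by omega)).trans (hb.2.2.1 q (by omega)).le

lemma IsBBPartition.index_unique {m l : ℕ} {b : ℕ → ℕ} (hb : IsBBPartition m l b) {p q i : ℕ}
    (hp : p < l) (hq : q < l) (h1 : b p ≤ i) (h2 : i < b (p + 1)) (h3 : b q ≤ i)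
    (h4 : i < b (q + 1)) : p = q := by
  by_contra hne
  rcases Nat.lt_or_gt_of_ne hne with h | h
  · have := hb.mono (p := p + 1) (q := q) h hq.le
    omega
  · have := hb.mono (p := q + 1) (q := p) h hp.le
    omega

lemma IsBBFun.eq_decide {m l : ℕ} {b : ℕ → ℕ} {BB : Pt m → Bool} (hb : IsBBPartition m l b)
    (hBB : IsBBFun m l b BB) {p : ℕ} (hp : p < l) {y : Pt m} (h1 : b p ≤ wt y)
    (h2 : wt y < b (p + 1)) : BB y = decide (Even p) := by
  rw [Bool.eq_iff_iff, hBB, decide_eq_true_eq]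
  constructor
  · rintro ⟨i, hi, he, h3, h4⟩
    rwa [hb.index_unique hp hi h1 h2 h3 h4]
  · exact fun he => ⟨p, hp, he, h1, h2⟩

/-- Along every maximal chain, an `s`-monotone function disagrees with a balanced-blocks function
throughout at least `s` out of `3 * s` blocks. -/
lemma card_disagree_numChain_ge {m s : ℕ} {b : ℕ → ℕ} {BB g : Pt m → Bool}
    (hb : IsBBPartition m (3 * s) b) (hBB : IsBBFun m (3 * s) b BB) (hg : IsKMono s g)
    {β : ℝ} (hβ0 : 0 ≤ β)
    (hβ : ∀ p < 3 * s, β ≤ (#{y : Pt m | b p ≤ wt y ∧ wt y < b (p + 1)} : ℝ))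
    (σ : Numbering (Fin m)) :
    s * β ≤ (#{y : Pt m | BB (numChain σ (wt y)) ≠ g (numChain σ (wt y))} : ℝ) := by
  let good : ℕ → Prop := fun p =>
    ∃ i, b p ≤ i ∧ i < b (p + 1) ∧ g (numChain σ i) = decide (Even p)
  classical
  let S := (range (3 * s / 2)).filter (fun q => good (2 * q) ∧ good (2 * q + 1))
  have hS : 2 * #S ≤ s := by
    by_contra! hlt
    have ha : ∀ q : ℕ, ∃ i, q ∈ S → b (2 * q) ≤ i ∧ i < b (2 * q + 1) ∧
        g (numChain σ i) = true := by
      intro q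
      by_cases hq : q ∈ S
      · obtain ⟨i, h⟩ := (mem_filter.1 hq).2.1
        exact ⟨i, fun _ => by simpa using h⟩
      · exact ⟨0, fun h => absurd h hq⟩
    have hc : ∀ q : ℕ, ∃ i, q ∈ S → b (2 * q + 1) ≤ i ∧ i < b (2 * q + 2) ∧
        g (numChain σ i) = false := by
      intro q
      by_cases hq : q ∈ S
      · obtain ⟨i, h⟩ := (mem_filter.1 hq).2.2
        exact ⟨i, fun _ => by simpa [Nat.even_add_one] using h⟩
      · exact ⟨0, fun h => absurd h hq⟩
    choose a ha using ha
    choose c hc using hc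
    have hSlt : ∀ q ∈ S, 2 * q + 2 ≤ 3 * s := fun q hq => by
      have := mem_range.1 (mem_filter.1 hq).1
      omega
    obtain ⟨t, ht, hta, htc⟩ := exists_interleaving hlt (a := a) (c := c)
      (fun q hq => by have := ha q hq; have := hc q hq; omega)
      (fun q hq q' hq' h => by
        have := ha q' hq'
        have := hc q hq
        have := hb.mono (p := 2 * q + 2) (q := 2 * q') (by omega) (by have := hSlt q' hq'; omega)
        omega)
    have hle : ∀ i ≤ s, t i ≤ m := by
      intro i hi
      by_cases h : Even i
      · obtain ⟨q, hq, h⟩ := hta i hi h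
        have := ha q hq
        have := hb.mono (p := 2 * q + 1) (q := 3 * s) (by have := hSlt q hq; omega) le_rfl
        have := hb.2.1
        omega
      · obtain ⟨q, hq, h⟩ := htc i hi h
        have := hc q hq
        have := hb.mono (p := 2 * q + 2) (q := 3 * s) (hSlt q hq) le_rfl
        have := hb.2.1
        omega
    have hval : ∀ i ≤ s, g (numChain σ (t i)) = decide (Even i) := by
      intro i hi
      by_cases h : Even i
      · obtain ⟨q, hq, h'⟩ := hta i hi h
        simp [h', h, (ha q hq).2.2]
      · obtain ⟨q, hq, h'⟩ := htc i hi h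
        simp [h', h, (hc q hq).2.2]
    refine hg ⟨fun i => numChain σ (t i), fun i hi => plt_numChain σ (ht i hi) (hle _ hi), ?_, ?_⟩
    · simpa using hval 0 (Nat.zero_le _)
    · intro i hi
      simp only [hval i hi.le, hval (i + 1) hi, Nat.even_add_one]
      by_cases h : Even i <;> simp [h]
  let B := (range (3 * s / 2)).filter (fun q => ¬ (good (2 * q) ∧ good (2 * q + 1)))
  have hB : s ≤ #B := by
    have : #S + #B = #(range (3 * s / 2)) := card_filter_add_card_filter_not _
    rw [card_range] at this
    omega
  have hpex : ∀ q : ℕ, ∃ p, p / 2 = q ∧ (q ∈ B → ¬ good p) := by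
    intro q
    by_cases hq : q ∈ B
    · by_cases h : good (2 * q)
      · refine ⟨2 * q + 1, by omega, fun _ h' => (mem_filter.1 hq).2 ⟨h, h'⟩⟩
      · exact ⟨2 * q, by omega, fun _ => h⟩
    · exact ⟨2 * q, by omega, fun h => absurd h hq⟩
  choose p hpq hp using hpex
  have hplt : ∀ q ∈ B, p q < 3 * s := fun q hq => by
    have := mem_range.1 (mem_filter.1 hq).1
    have := hpq q
    omega
  have hsub : B.biUnion (fun q => univ.filter
      (fun y : Pt m => b (p q) ≤ wt y ∧ wt y < b (p q + 1)))
      ⊆ univ.filter (fun y : Pt m => BB (numChain σ (wt y)) ≠ g (numChain σ (wt y))) := by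
    intro y hy
    simp only [mem_biUnion, mem_filter, mem_univ, true_and] at hy ⊢
    obtain ⟨q, hq, h1, h2⟩ := hy
    rw [hBB.eq_decide hb (hplt q hq) (by rwa [wt_numChain σ (wt_le y)])
      (by rwa [wt_numChain σ (wt_le y)])]
    exact fun h => hp q hq ⟨wt y, h1, h2, h.symm⟩
  have hdisj : ∀ q ∈ B, ∀ q' ∈ B, q ≠ q' →
      Disjoint (univ.filter (fun y : Pt m => b (p q) ≤ wt y ∧ wt y < b (p q + 1)))
        (univ.filter (fun y : Pt m => b (p q') ≤ wt y ∧ wt y < b (p q' + 1))) := by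
    intro q hq q' hq' hne
    rw [disjoint_left]
    intro y hy hy'
    simp only [mem_filter, mem_univ, true_and] at hy hy'
    have := hb.index_unique (hplt q hq) (hplt q' hq') hy.1 hy.2 hy'.1 hy'.2
    exact hne (by rw [← hpq q, ← hpq q', this])
  calc s * β ≤ #B * β := by gcongr
    _ = ∑ q ∈ B, β := by simp
    _ ≤ ∑ q ∈ B, (#{y : Pt m | b (p q) ≤ wt y ∧ wt y < b (p q + 1)} : ℝ) :=
        sum_le_sum fun q hq => hβ _ (hplt q hq)
    _ ≤ _ := by
      rw [← Nat.cast_sum, ← card_biUnion hdisj]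
      exact_mod_cast card_le_card hsub

/-- Balanced-blocks functions with `3 * s` blocks are far from `s`-monotone. -/
lemma card_disagree_ge {m s : ℕ} (hs : 0 < s) (hm : (6 : ℝ) * s ≤ √m) {b : ℕ → ℕ}
    {BB g : Pt m → Bool} (hb : IsBBPartition m (3 * s) b) (hBB : IsBBFun m (3 * s) b BB)
    (hg : IsKMono s g) : (2 : ℝ) ^ m / 6 ≤ #{y : Pt m | BB y ≠ g y} := by
  have hs' : (0 : ℝ) < s := by exact_mod_cast hs
  have hr : (3 * s : ℝ) / √m ≤ 1 / 2 := by
    rw [div_le_iff₀ (by linarith)]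
    linarith
  have hβ : ∀ p < 3 * s, (2 : ℝ) ^ m / (6 * s) ≤
      (#{y : Pt m | b p ≤ wt y ∧ wt y < b (p + 1)} : ℝ) := by
    intro p hp
    have h := (hb.2.2.2 p hp).1
    rw [Set.ncard_eq_toFinset_card', Set.toFinset_ofPred] at h
    refine le_trans ?_ h
    push_cast
    rw [div_le_div_iff₀ (by positivity) (by positivity)]
    have : 0 ≤ (2 : ℝ) ^ m * s * (1 / 2 - 3 * s / √m) :=
      mul_nonneg (by positivity) (by linarith)
    nlinarith
  have h1 := fun σ => card_disagree_numChain_ge hb hBB hg (by positivity) hβ σ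
  have h2 := sum_card_numChain (fun y => BB y ≠ g y)
  have h3 := sum_le_sum (s := univ) fun σ _ => h1 σ
  rw [← Nat.cast_sum, h2, sum_const, card_univ, Fintype.card_numbering, Fintype.card_fin,
    nsmul_eq_mul, Nat.cast_mul] at h3
  have h4 := le_of_mul_le_mul_left h3 (by exact_mod_cast m.factorial_pos)
  refine le_trans (le_of_eq ?_) h4
  field_simp

lemma four_pow_sq_le_centralBinom (h : ℕ) (hh : 1 ≤ h) :
    (4 ^ h) ^ 2 ≤ 4 * h * h.centralBinom ^ 2 := by
  induction h, hh using Nat.le_induction with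
  | base => decide
  | succ h hh ih =>
    have h1 := Nat.succ_mul_centralBinom_succ h
    have h2 : 0 < h + 1 := by omega
    refine Nat.le_of_mul_le_mul_left (c := h + 1) ?_ h2
    have h3 : (h + 1) * (4 * (h + 1) * (h + 1).centralBinom ^ 2)
        = 4 * (2 * (2 * h + 1) * h.centralBinom) ^ 2 := by
      rw [← h1]
      ring
    rw [h3, pow_succ]
    calc (h + 1) * (4 ^ h * 4) ^ 2 = 16 * (h + 1) * (4 ^ h) ^ 2 := by ring
      _ ≤ 16 * (h + 1) * (4 * h * h.centralBinom ^ 2) := by gcongr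
      _ = 4 * (h * (h + 1) * 16) * h.centralBinom ^ 2 := by ring
      _ ≤ 4 * (2 * (2 * h + 1)) ^ 2 * h.centralBinom ^ 2 := by
        gcongr
        nlinarith
      _ = _ := by ring

lemma two_pow_le_sqrt_mul_choose_half {m : ℕ} (hm : 2 ≤ m) :
    (2 : ℝ) ^ m ≤ 4 * √m * m.choose (m / 2) := by
  have key : (2 ^ m) ^ 2 ≤ 16 * m * m.choose (m / 2) ^ 2 := by
    have h1 := four_pow_sq_le_centralBinom (m / 2) (by omega)
    have h2 : (m / 2).centralBinom ≤ m.choose (m / 2) := by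
      rw [Nat.centralBinom_eq_two_mul_choose]
      exact Nat.choose_le_choose _ (by omega)
    have h3 : 2 ^ m ≤ 2 * 4 ^ (m / 2) := by
      rw [show 4 = 2 ^ 2 by rfl, ← pow_mul, ← pow_succ']
      exact Nat.pow_le_pow_right (by omega) (by omega)
    calc (2 ^ m) ^ 2 ≤ (2 * 4 ^ (m / 2)) ^ 2 := by gcongr
      _ = 4 * (4 ^ (m / 2)) ^ 2 := by ring
      _ ≤ 4 * (4 * (m / 2) * (m / 2).centralBinom ^ 2) := by gcongr
      _ ≤ 4 * (4 * m * m.choose (m / 2) ^ 2) := by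
        gcongr
        exact Nat.div_le_self m 2
      _ = _ := by ring
  refine le_of_sq_le_sq ?_ (by positivity)
  rw [mul_pow, mul_pow, Real.sq_sqrt (by positivity)]
  have : ((2 : ℝ) ^ m) ^ 2 ≤ 16 * m * (m.choose (m / 2) : ℝ) ^ 2 := by exact_mod_cast key
  linarith

lemma choose_half_sub_ge {m j : ℕ} (hm : 2 ≤ m) (hj : j ≤ m / 2)
    (hj' : j * (j + 1) ≤ m / 2) :
    (m.choose (m / 2) : ℝ) * (1 - j * (j + 1) / (m / 2 : ℕ)) ≤ m.choose (m / 2 - j) := by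
  induction j with
  | zero => simp
  | succ j ih =>
    have h0 : (0 : ℝ) < (m / 2 : ℕ) := by
      have : 0 < m / 2 := by omega
      exact_mod_cast this
    have ih := ih (by omega) (by nlinarith)
    have hrec := Nat.choose_succ_right_eq m (m / 2 - (j + 1))
    have e1 : m / 2 - (j + 1) + 1 = m / 2 - j := by omega
    rw [e1] at hrec
    have hle : m - (m / 2 - (j + 1)) ≤ m / 2 + j + 2 := by omega
    have hrec' : m.choose (m / 2 - j) * (m / 2 - j) ≤
        m.choose (m / 2 - (j + 1)) * (m / 2 + j + 2) := by
      rw [hrec]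
      gcongr
    have hrecR : (m.choose (m / 2 - j) : ℝ) * ((m / 2 : ℕ) - j) ≤
        m.choose (m / 2 - (j + 1)) * ((m / 2 : ℕ) + j + 2) := by
      rw [← Nat.cast_sub (by omega : j ≤ m / 2)]
      exact_mod_cast hrec'
    have hbd : (j + 1 : ℝ) * (j + 2) ≤ (m / 2 : ℕ) := by
      exact_mod_cast hj'
    have hjR : (j : ℝ) + 1 ≤ (m / 2 : ℕ) := by exact_mod_cast hj
    generalize (m.choose (m / 2 - (j + 1)) : ℝ) = A at *
    generalize (m.choose (m / 2 - j) : ℝ) = A' at *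
    have hC : (0 : ℝ) ≤ m.choose (m / 2) := by positivity
    generalize (m.choose (m / 2) : ℝ) = C at *
    generalize ((m / 2 : ℕ) : ℝ) = h at *
    push_cast
    have hjn : (0 : ℝ) ≤ j := by positivity
    generalize (j : ℝ) = x at *
    refine le_of_mul_le_mul_right ?_ (by linarith : 0 < h + x + 2)
    refine le_trans ?_ hrecR
    refine le_trans ?_ (mul_le_mul_of_nonneg_right ih (by linarith))
    rw [mul_assoc, mul_assoc]
    refine mul_le_mul_of_nonneg_left ?_ hC
    have e2 : (1 - (x + 1) * (x + 1 + 1) / h) = (h - (x + 1) * (x + 2)) / h := by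
      field_simp
      ring
    have e3 : (1 - x * (x + 1) / h) = (h - x * (x + 1)) / h := by
      field_simp
    rw [e2, e3, div_mul_eq_mul_div, div_mul_eq_mul_div]
    refine div_le_div_of_nonneg_right ?_ h0.le
    nlinarith [mul_nonneg hjn hjn, mul_nonneg (mul_nonneg hjn hjn) hjn]

open Classical in
/-- A constant fraction of the hypercube lies in the middle levels. -/
lemma card_midL_ge {m : ℕ} (hm : 10000 ≤ m) :
    (2 : ℝ) ^ m / 1600 ≤ #{x : Pt m | midL m (wt x)} := by
  have hmR : (10000 : ℝ) ≤ m := by exact_mod_cast hm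
  have hsq : √(m : ℝ) ^ 2 = m := Real.sq_sqrt (by positivity)
  have h100 : (100 : ℝ) ≤ √m := Real.le_sqrt_of_sq_le (by linarith)
  let J := ⌊√(m : ℝ) / 100⌋₊
  have hJ : (J : ℝ) ≤ √m / 100 := Nat.floor_le (by positivity)
  have hJ' : √m / 200 ≤ (J : ℝ) := by
    have := Nat.lt_floor_add_one (√(m : ℝ) / 100)
    have h1 : (1 : ℝ) ≤ J := by
      have : 1 ≤ J := Nat.le_floor (by push_cast; linarith)
      exact_mod_cast this
    change _ < (J : ℝ) + 1 at this
    linarith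
  have hmh : (m : ℝ) ≤ 2 * (m / 2 : ℕ) + 1 := by
    have : m ≤ 2 * (m / 2) + 1 := by omega
    exact_mod_cast this
  have hmh' : 2 * ((m / 2 : ℕ) : ℝ) ≤ m := by
    have : 2 * (m / 2) ≤ m := by omega
    exact_mod_cast this
  have hJJ : (J : ℝ) * J ≤ m / 10000 := by nlinarith [Nat.cast_nonneg (α := ℝ) J]
  have hjle : ∀ j < J, ((j : ℝ) + 1) ≤ J := fun j hj => by exact_mod_cast hj
  have hjj : ∀ j < J, (j : ℝ) * (j + 1) ≤ m / 10000 := fun j hj => by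
    have := hjle j hj
    nlinarith [Nat.cast_nonneg (α := ℝ) j]
  have hchoose : ∀ j ∈ range J, (2 : ℝ) ^ m / (8 * √m) ≤ m.choose (m / 2 - j) := by
    intro j hj
    have hj := mem_range.1 hj
    have hjm := hjj j hj
    have hjN : j * (j + 1) ≤ m / 2 := by
      have : (j : ℝ) * (j + 1) ≤ (m / 2 : ℕ) := by linarith
      exact_mod_cast this
    have h1 := choose_half_sub_ge (m := m) (j := j) (by omega) (by nlinarith) hjN
    have h2 := two_pow_le_sqrt_mul_choose_half (m := m) (by omega)
    have h3 : (j : ℝ) * (j + 1) / (m / 2 : ℕ) ≤ 1 / 2 := by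
      rw [div_le_iff₀ (by linarith)]
      linarith
    rw [div_le_iff₀ (by positivity)]
    have h4 : (m.choose (m / 2) : ℝ) * (1 / 2) ≤ m.choose (m / 2 - j) :=
      (mul_le_mul_of_nonneg_left (by linarith) (by positivity)).trans h1
    nlinarith
  have hJlt : ∀ j ∈ range J, j ≤ m / 2 := fun j hj => by
    have hj := mem_range.1 hj
    have := hjj j hj
    have : (j : ℝ) * (j + 1) ≤ (m / 2 : ℕ) := by linarith
    have : j * (j + 1) ≤ m / 2 := by exact_mod_cast this
    nlinarith
  have hsub : (range J).biUnion (fun j => univ.filter (fun x : Pt m => wt x = m / 2 - j))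
      ⊆ univ.filter (fun x : Pt m => midL m (wt x)) := by
    intro x hx
    simp only [mem_biUnion, mem_filter, mem_univ, true_and] at hx ⊢
    obtain ⟨j, hj, hx⟩ := hx
    have h1 := hjle j (mem_range.1 hj)
    rw [midL, hx, Nat.cast_sub (hJlt j hj), abs_le]
    constructor <;> linarith [Nat.cast_nonneg (α := ℝ) j]
  have hdisj : ∀ i ∈ range J, ∀ j ∈ range J, i ≠ j →
      Disjoint (univ.filter (fun x : Pt m => wt x = m / 2 - i))
        (univ.filter (fun x : Pt m => wt x = m / 2 - j)) := by
    intro i hi j hj hne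
    rw [disjoint_left]
    intro x hx hx'
    simp only [mem_filter, mem_univ, true_and] at hx hx'
    have := hJlt i hi
    have := hJlt j hj
    omega
  calc (2 : ℝ) ^ m / 1600 = √m / 200 * (2 ^ m / (8 * √m)) := by
        field_simp
        norm_num
    _ ≤ J * (2 ^ m / (8 * √m)) := by gcongr
    _ = ∑ j ∈ range J, (2 : ℝ) ^ m / (8 * √m) := by simp
    _ ≤ ∑ j ∈ range J, (m.choose (m / 2 - j) : ℝ) := sum_le_sum hchoose
    _ ≤ _ := by
      simp_rw [← card_wt_eq]
      rw [← Nat.cast_sum, ← card_biUnion hdisj]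
      exact_mod_cast card_le_card hsub

lemma wL_append {nL nR : ℕ} (x : Pt nL) (y : Pt nR) :
    wL nL (Fin.append x y : Pt (nL + nR)) = wt x := by
  rw [wL, wt, ← card_map (s := univ.filter (fun i => x i = true)) (Fin.castAddEmb nR)]
  refine congrArg card (Finset.ext fun i => ?_)
  simp only [mem_filter, mem_univ, true_and, mem_map]
  constructor
  · rintro ⟨hi, h⟩
    have e : i = Fin.castAdd nR ⟨i, hi⟩ := rfl
    rw [e, Fin.append_left] at h
    exact ⟨_, h, rfl⟩
  · rintro ⟨j, hj, rfl⟩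
    exact ⟨j.2, by simpa [Fin.castAddEmb] using hj⟩

lemma yPart_append {nL nR : ℕ} (x : Pt nL) (y : Pt nR) :
    yPart nL nR rfl (Fin.append x y : Pt (nL + nR)) = y := by
  funext j
  exact Fin.append_right x y j

lemma IsKMono.append {nL nR s : ℕ} {g : Pt (nL + nR) → Bool} (hg : IsKMono s g) (x : Pt nL) :
    IsKMono s (fun y : Pt nR => g (Fin.append x y)) := by
  rintro ⟨c, h1, h2, h3⟩
  refine hg ⟨fun i => Fin.append x (c i), fun i hi => ⟨fun a => ?_, fun h => ?_⟩, h2, h3⟩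
  · refine Fin.addCases (fun a => ?_) (fun a => ?_) a
    · simp only [Fin.append_left, le_refl]
    · simpa only [Fin.append_right] using (h1 i hi).1 a
  · refine (h1 i hi).2 (funext fun a => ?_)
    simpa only [Fin.append_right] using congrFun h (Fin.natAdd nL a)

open Classical in
/-- Counting disagreements fibre by fibre over the middle levels. -/
lemma IsHardFun.card_disagree_ge {nL nR : ℕ} {BB : Pt nR → Bool} {f g : Pt (nL + nR) → Bool}
    (hf : IsHardFun nL nR rfl BB f) {c : ℝ}
    (hc : ∀ x : Pt nL, c ≤ #{y : Pt nR | BB y ≠ g (Fin.append x y)}) :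
    #{x : Pt nL | midL nL (wt x)} * c ≤ #{z : Pt (nL + nR) | f z ≠ g z} := by
  have hval : ∀ x : Pt nL, midL nL (wt x) → ∀ y : Pt nR, f (Fin.append x y) = BB y := by
    intro x hx y
    have := (hf (Fin.append x y)).1 (by rwa [wL_append])
    rwa [yPart_append] at this
  have hcard : #((univ.filter (fun x : Pt nL => midL nL (wt x))).sigma
      (fun x => univ.filter (fun y : Pt nR => BB y ≠ g (Fin.append x y))))
      ≤ #{z : Pt (nL + nR) | f z ≠ g z} := by
    refine card_le_card_of_injOn (fun p => Fin.append p.1 p.2) ?_ ?_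
    · rintro ⟨x, y⟩ hp
      simp only [coe_sigma, coe_filter, mem_univ, true_and, Set.mem_sigma_iff,
        Set.mem_ofPred_eq] at hp ⊢
      rw [hval x hp.1]
      exact hp.2
    · rintro ⟨x, y⟩ _ ⟨x', y'⟩ _ h
      have hx : x = x' := funext fun i => by
        simpa only [Fin.append_left] using congrFun h (Fin.castAdd nR i)
      have hy : y = y' := funext fun i => by
        simpa only [Fin.append_right] using congrFun h (Fin.natAdd nL i)
      rw [hx, hy]
  rw [card_sigma] at hcard
  calc _ = ∑ x : Pt nL with midL nL (wt x), c := by simp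
    _ ≤ ∑ x : Pt nL with midL nL (wt x), (#{y : Pt nR | BB y ≠ g (Fin.append x y)} : ℝ) :=
        sum_le_sum fun x _ => hc x
    _ ≤ _ := by exact_mod_cast hcard

/-- There are absolute constants `ε₀ > 0` and `N₀` such that for every even
`k ≥ 2`, every `s ≥ k`, and all positive `n, n_R` with `k²·n = 625·s²·n_R`, `n_L = n − n_R`,
`N₀·s ≤ √n_R` and `n ≥ N₀`, the hard function `f` built from any balanced-blocks function on
`{0,1}^{n_R}` with `3s` blocks is at distance at least `ε₀` from every `s`-monotone `g`. -/
theorem stmt2 :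
    ∃ ε₀ : ℝ, 0 < ε₀ ∧ ∃ N₀ : ℕ,
      ∀ (k s n nR nL : ℕ), 2 ≤ k → Even k → k ≤ s → 0 < n → 0 < nR →
        k ^ 2 * n = 625 * s ^ 2 * nR → nL = n - nR →
        ∀ hsum : nL + nR = n,
        ((N₀ : ℝ) * s ≤ Real.sqrt nR) → N₀ ≤ n →
        ∀ (b : ℕ → ℕ) (BB : Pt nR → Bool),
          IsBBPartition nR (3 * s) b → IsBBFun nR (3 * s) b BB →
          ∀ f : Pt n → Bool, IsHardFun nL nR hsum BB f →
            ∀ g : Pt n → Bool, IsKMono s g → ε₀ ≤ hdist f g := by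
  refine ⟨1 / 9600, by norm_num, 20000, ?_⟩
  intro k s n nR nL hk _ hks _ _ heq _ hsum hN hn b BB hb hBB f hf g hg
  subst hsum
  have hs : 0 < s := by omega
  have hnR : 625 * nR ≤ nL + nR := by
    refine Nat.le_of_mul_le_mul_left (c := k ^ 2) ?_ (by positivity)
    rw [heq]
    calc k ^ 2 * (625 * nR) = 625 * k ^ 2 * nR := by ring
      _ ≤ 625 * s ^ 2 * nR := by gcongr
  have h6 : (6 : ℝ) * s ≤ √nR := by
    refine le_trans ?_ hN
    gcongr
    norm_num
  have h1 := card_midL_ge (m := nL) (by omega)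
  have h2 := hf.card_disagree_ge (g := g)
    fun x => card_disagree_ge hs h6 hb hBB (hg.append x)
  rw [hdist, Set.ncard_eq_toFinset_card', Set.toFinset_ofPred, le_div_iff₀ (by positivity)]
  calc (1 / 9600 : ℝ) * 2 ^ (nL + nR) = 2 ^ nL / 1600 * (2 ^ nR / 6) := by
        rw [pow_add]
        ring
    _ ≤ _ := mul_le_mul_of_nonneg_right h1 (by positivity)
    _ ≤ _ := h2
    _ = _ := by norm_num
end

section
/- There exists an absolute constant N₀ such that the following holds. Let k and s be integers with 2 ≤ k ≤ s, let r = s/k, and let n, n_R be positive integers with k²·n = 625·s²·n_R, n_L = n − n_R, and n ≥ N₀·r⁴. Then the probability, over a uniformly random maximal chain Z in {0,1}^n, that |V(Z)| ≥ √n/(500·r²) is at most exp(−√n/(90000·r²)). -/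
/-- The number of positions `q < i` of the word `c` carrying the letter `b`. -/
def countBelow {n : ℕ} (b : Bool) (c : Fin n → Bool) (i : ℕ) : ℕ :=
  (Finset.univ.filter (fun q : Fin n => c q = b ∧ (q : ℕ) < i)).card

/-- The number of letters `false` of the word `c` that are preceded by `a` letters `true`
with `P (g + a)`. -/
def windowCount {n : ℕ} (P : ℕ → Prop) [DecidablePred P] (g : ℕ) (c : Fin n → Bool) : ℕ :=
  (Finset.univ.filter (fun p : Fin n => c p = false ∧ P (g + countBelow true c p))).card

lemma countBelow_mono {n : ℕ} (b : Bool) (c : Fin n → Bool) : Monotone (countBelow b c) := by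
  intro i j hij
  refine Finset.card_le_card fun q hq => ?_
  simp only [Finset.mem_filter, Finset.mem_univ, true_and] at hq ⊢
  exact ⟨hq.1, hq.2.trans_le hij⟩

lemma countBelow_succ {n : ℕ} (b : Bool) (c : Fin n → Bool) (p : Fin n) :
    countBelow b c (p + 1) = countBelow b c p + if c p = b then 1 else 0 := by
  unfold countBelow
  split_ifs with h
  · rw [← Finset.card_insert_of_notMem (a := p) (by simp)]
    congr 1
    ext q
    simp only [Finset.mem_filter, Finset.mem_univ, true_and, Finset.mem_insert, Fin.ext_iff]
    constructor
    · rintro ⟨h1, h2⟩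
      by_cases hq : (q : ℕ) = p
      · exact Or.inl hq
      · exact Or.inr ⟨h1, by omega⟩
    · rintro (hq | ⟨h1, h2⟩)
      · obtain rfl : q = p := Fin.ext hq
        exact ⟨h, by omega⟩
      · exact ⟨h1, by omega⟩
  · rw [add_zero]
    congr 1
    ext q
    simp only [Finset.mem_filter, Finset.mem_univ, true_and]
    refine and_congr_right fun h1 => ⟨fun h2 => ?_, fun h2 => by omega⟩
    have : (q : ℕ) ≠ p := fun hq => h (by rw [← Fin.ext hq]; exact h1)
    omega

lemma countBelow_succ_cons {n : ℕ} (b : Bool) (c : Fin (n + 1) → Bool) (i : ℕ) :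
    countBelow b c (i + 1) =
      (if c 0 = b then 1 else 0) + countBelow b (fun x => c x.succ) i := by
  simp only [countBelow, Finset.card_filter, Fin.sum_univ_succ, Fin.val_zero, Fin.val_succ,
    Nat.succ_pos, and_true, Nat.add_lt_add_iff_right]

lemma windowCount_cons {n : ℕ} (P : ℕ → Prop) [DecidablePred P] (g : ℕ)
    (c : Fin (n + 1) → Bool) :
    windowCount P g c = (if c 0 = false ∧ P g then 1 else 0) +
      windowCount P (g + if c 0 = true then 1 else 0) (fun x => c x.succ) := by
  have h0 : countBelow true c 0 = 0 := by simp [countBelow]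
  simp only [windowCount, Finset.card_filter, Fin.sum_univ_succ, Fin.val_zero, Fin.val_succ,
    countBelow_succ_cons, h0, add_zero, add_assoc]

/-- The letters `false` seen while the number of letters `true` lies in an order-convex set `P`
account for all but one value of the number of letters `false`. -/
lemma ncard_countBelow_le {n : ℕ} (P : ℕ → Prop) [DecidablePred P]
    (hP : ∀ a b x, P a → P b → a ≤ x → x ≤ b → P x) (c : Fin n → Bool) :
    {j | ∃ i ≤ n, P (countBelow true c i) ∧ countBelow false c i = j}.ncard ≤
      windowCount P 0 c + 1 := by
  set V := {j | ∃ i ≤ n, P (countBelow true c i) ∧ countBelow false c i = j} with hV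
  rcases V.eq_empty_or_nonempty with h | hne
  · simp [h]
  set S := Finset.univ.filter
    (fun p : Fin n => c p = false ∧ P (0 + countBelow true c p)) with hS
  set T := insert (sInf V) (S.image fun p : Fin n => countBelow false c p + 1) with hT
  have hsub : V ⊆ (T : Set ℕ) := by
    intro j hj
    obtain ⟨i₀, hi₀, hP₀, hj₀⟩ := Nat.sInf_mem hne
    have hle : sInf V ≤ j := Nat.sInf_le hj
    obtain ⟨i, hi, hPi, hji⟩ := hj
    rw [hT, Finset.coe_insert, Set.mem_insert_iff]
    rcases hle.eq_or_lt with h | hlt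
    · exact Or.inl h.symm
    refine Or.inr ?_
    have hex : ∃ t, j ≤ countBelow false c t := ⟨i, hji.ge⟩
    have hspec := Nat.find_spec hex
    have hfi : Nat.find hex ≤ i := Nat.find_min' hex hji.ge
    have h0f : i₀ < Nat.find hex := by
      by_contra hcon
      have := countBelow_mono false c (not_lt.1 hcon)
      omega
    obtain ⟨p, hp⟩ : ∃ p, Nat.find hex = p + 1 := ⟨Nat.find hex - 1, by omega⟩
    have hmin : ¬ j ≤ countBelow false c p := Nat.find_min hex (by omega)
    rw [hp] at hspec
    have hs := countBelow_succ false c ⟨p, by omega⟩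
    simp only at hs
    have hcp : c ⟨p, by omega⟩ = false := by
      by_contra hcon
      rw [if_neg hcon] at hs
      omega
    rw [if_pos hcp] at hs
    simp only [Finset.coe_image, Set.mem_image, Finset.mem_coe]
    refine ⟨⟨p, by omega⟩, ?_, by simp only; omega⟩
    simp only [hS, Finset.mem_filter, Finset.mem_univ, true_and, zero_add]
    exact ⟨hcp, hP _ _ _ hP₀ hPi (countBelow_mono true c (by omega))
      (countBelow_mono true c (by omega))⟩
  calc V.ncard ≤ (T : Set ℕ).ncard := Set.ncard_le_ncard hsub T.finite_toSet
    _ = T.card := Set.ncard_coe_finset T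
    _ ≤ (S.image fun p : Fin n => countBelow false c p + 1).card + 1 := Finset.card_insert_le _ _
    _ ≤ S.card + 1 := by gcongr; exact Finset.card_image_le
    _ = windowCount P 0 c + 1 := rfl

lemma wL_chainOf {n : ℕ} (nL : ℕ) (σ : Equiv.Perm (Fin n)) (i : ℕ) :
    wL nL (chainOf σ i) = countBelow true (fun q => decide ((σ q : ℕ) < nL)) i := by
  unfold wL countBelow chainOf
  refine Finset.card_equiv σ.symm fun j => ?_
  simp

lemma wR_chainOf {n : ℕ} (nL : ℕ) (σ : Equiv.Perm (Fin n)) (i : ℕ) :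
    wR nL (chainOf σ i) = countBelow false (fun q => decide ((σ q : ℕ) < nL)) i := by
  unfold wR countBelow chainOf
  refine Finset.card_equiv σ.symm fun j => ?_
  simp

lemma sum_perm_succ {n : ℕ} (F : (Fin (n + 1) → Bool) → ℝ) (c : Fin (n + 1) → Bool) :
    ∑ σ : Equiv.Perm (Fin (n + 1)), F (fun x => c (σ x)) =
      ∑ p : Fin (n + 1), ∑ τ : Equiv.Perm (Fin n),
        F (fun x => c (Equiv.Perm.decomposeFin.symm (p, τ) x)) := by
  rw [← Equiv.Perm.decomposeFin.symm.sum_comp, Fintype.sum_prod_type]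

lemma card_filter_swap_succ {n : ℕ} (c : Fin (n + 1) → Bool) (p : Fin (n + 1)) (b : Bool) :
    (Finset.univ.filter (fun x : Fin n => c (Equiv.swap 0 p x.succ) = b)).card +
      (if c p = b then 1 else 0) = (Finset.univ.filter (fun x => c x = b)).card := by
  have h : (Finset.univ.filter (fun x => c x = b)).card =
      (Finset.univ.filter (fun x => c (Equiv.swap 0 p x) = b)).card :=
    Finset.card_equiv (Equiv.swap 0 p) fun j => by simp
  rw [h]
  simp only [Finset.card_filter, Fin.sum_univ_succ, Equiv.swap_apply_left]
  exact add_comm _ _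

/-- Exponential moment bound for `windowCount` of a uniformly random rearrangement of a word. -/
lemma sum_two_pow_windowCount_le (P : ℕ → Prop) [DecidablePred P] (N m : ℕ) (C : ℝ)
    (hC : 1 ≤ C) (hP : ∀ i, P i → (m : ℝ) ≤ ((N : ℝ) - i) * (1 - 1 / C)) :
    ∀ (n g : ℕ) (c : Fin n → Bool),
      g + (Finset.univ.filter (fun x => c x = true)).card = N →
      (Finset.univ.filter (fun x => c x = false)).card ≤ m →
      ∑ σ : Equiv.Perm (Fin n), (2 : ℝ) ^ windowCount P g (fun x => c (σ x)) ≤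
        n.factorial * ∏ i ∈ Finset.Ico g (N + 1), (if P i then C else 1) := by
  have hone : ∀ g, 1 ≤ ∏ i ∈ Finset.Ico g (N + 1), (if P i then C else 1) := fun g =>
    Finset.prod_induction _ (fun x : ℝ => 1 ≤ x)
      (fun _ _ => one_le_mul_of_one_le_of_one_le) le_rfl
      (fun i _ => by split_ifs <;> linarith)
  intro n
  induction n with
  | zero =>
    intro g c _ _
    simpa [windowCount] using hone g
  | succ n ih =>
    intro g c hL hR
    set B : ℕ → ℝ := fun g => ∏ i ∈ Finset.Ico g (N + 1), (if P i then C else 1) with hB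
    set l := (Finset.univ.filter (fun x => c x = true)).card with hl
    set q := (Finset.univ.filter (fun x => c x = false)).card with hq
    have hlq : l + q = n + 1 := by
      have := Finset.card_filter_add_card_filter_not
        (s := (Finset.univ : Finset (Fin (n + 1)))) (fun x => c x = true)
      simpa [hl, hq] using this
    set w : ℝ := if P g then 2 else 1 with hw
    have hstep : ∀ p : Fin (n + 1), ∑ τ : Equiv.Perm (Fin n),
        (2 : ℝ) ^ windowCount P g (fun x => c (Equiv.Perm.decomposeFin.symm (p, τ) x)) ≤
        n.factorial * (if c p = true then B (g + 1) else w * B g) := by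
      intro p
      have hLp := card_filter_swap_succ c p true
      have hRp := card_filter_swap_succ c p false
      simp only [windowCount_cons, Equiv.Perm.decomposeFin_symm_apply_zero,
        Equiv.Perm.decomposeFin_symm_apply_succ, pow_add, ← Finset.mul_sum]
      cases hcp : c p with
      | true =>
        have := ih (g + 1) (fun x => c (Equiv.swap 0 p x.succ))
          (by simp only [hcp, if_true] at hLp; omega) (by omega)
        simpa [hcp] using this
      | false =>
        have := ih g (fun x => c (Equiv.swap 0 p x.succ))
          (by simp [hcp] at hLp; omega) (by omega)
        by_cases hg : P g
        · simp only [hg, hw]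
          simp
          nlinarith [this]
        · simpa [hg, hw] using this
    have hBg : B g = (if P g then C else 1) * B (g + 1) :=
      Finset.prod_eq_prod_Ico_succ_bot (by omega) _
    have hB1 := hone (g + 1)
    change 1 ≤ B (g + 1) at hB1
    have hlN : (l : ℝ) = N - g := by rw [← hL]; push_cast; ring
    have hmain : (l : ℝ) * B (g + 1) + q * (w * B g) ≤ (l + q) * B g := by
      rw [hBg, hw]
      split_ifs with hg
      · have h1 := hP g hg
        rw [← hlN] at h1
        have h2 : (q : ℝ) ≤ m := by exact_mod_cast hR
        have h3 : (q : ℝ) * C ≤ l * (C - 1) := by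
          have : (l : ℝ) * (1 - 1 / C) * C = l * (C - 1) := by field_simp
          rw [← this]
          gcongr
          linarith
        nlinarith
      · linarith
    rw [sum_perm_succ (fun d => (2 : ℝ) ^ windowCount P g d)]
    calc _ ≤ ∑ p : Fin (n + 1),
          (n.factorial : ℝ) * (if c p = true then B (g + 1) else w * B g) :=
          Finset.sum_le_sum fun p _ => hstep p
      _ = n.factorial * (l * B (g + 1) + q * (w * B g)) := by
          rw [← Finset.mul_sum, Finset.sum_ite]
          simp [hl, hq]
      _ ≤ n.factorial * ((l + q) * B g) := by gcongr
      _ = (n + 1).factorial * B g := by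
          have : (l : ℝ) + q = n + 1 := by exact_mod_cast hlq
          rw [this, Nat.factorial_succ]
          push_cast
          ring

lemma card_filter_midL_le (nL : ℕ) (s : Finset ℕ) [DecidablePred (midL nL)] :
    ((s.filter (midL nL)).card : ℝ) ≤ Real.sqrt nL / 50 + 1 := by
  set x : ℝ := nL / 2 with hx_def
  set d : ℝ := Real.sqrt nL / 100 with hd
  have hd0 : 0 ≤ d := by positivity
  have hsub : s.filter (midL nL) ⊆ Finset.Icc ⌈x - d⌉₊ ⌊x + d⌋₊ := by
    intro i hi
    have h := abs_le.1 (Finset.mem_filter.1 hi).2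
    rw [Finset.mem_Icc]
    exact ⟨Nat.ceil_le.2 (by linarith), Nat.le_floor (by linarith)⟩
  have hcard := Finset.card_le_card hsub
  rw [Nat.card_Icc] at hcard
  have hx : 0 ≤ x := by positivity
  have h1 := Nat.floor_le (add_nonneg hx hd0)
  have h2 := Nat.le_ceil (x - d)
  have h3 : Real.sqrt nL / 50 = 2 * d := by rw [hd]; ring
  rw [h3]
  rcases le_total ⌈x - d⌉₊ (⌊x + d⌋₊ + 1) with h | h
  · have : ((⌊x + d⌋₊ + 1 - ⌈x - d⌉₊ : ℕ) : ℝ) = (⌊x + d⌋₊ : ℝ) + 1 - ⌈x - d⌉₊ := by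
      push_cast [Nat.cast_sub h]
      ring
    have hc : ((s.filter (midL nL)).card : ℝ) ≤ ((⌊x + d⌋₊ + 1 - ⌈x - d⌉₊ : ℕ) : ℝ) := by
      exact_mod_cast hcard
    linarith
  · have : (s.filter (midL nL)).card = 0 := by omega
    rw [this]
    push_cast
    linarith

/-- Markov's inequality for a permutation statistic under the exponential `2 ^ X`. -/
lemma permProb_le_of_sum_two_pow_le {n : ℕ} (Q : Equiv.Perm (Fin n) → Prop)
    (X : Equiv.Perm (Fin n) → ℕ) (t K : ℝ) (hQ : ∀ σ, Q σ → t ≤ X σ)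
    (hsum : ∑ σ, (2 : ℝ) ^ X σ ≤ n.factorial * K) :
    permProb n Q ≤ K * Real.exp (-(t * Real.log 2)) := by
  classical
  have hset : {σ | Q σ}.ncard = (Finset.univ.filter Q).card := by
    rw [← Set.ncard_coe_finset]
    simp
  have hlow : ((Finset.univ.filter Q).card : ℝ) * Real.exp (t * Real.log 2) ≤
      ∑ σ, (2 : ℝ) ^ X σ := by
    rw [← nsmul_eq_mul]
    refine (Finset.card_nsmul_le_sum _ (fun σ => (2 : ℝ) ^ X σ) _ fun σ hσ => ?_).trans
      (Finset.sum_le_sum_of_subset_of_nonneg (Finset.filter_subset _ _) fun _ _ _ => by positivity)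
    have h := hQ σ (Finset.mem_filter.1 hσ).2
    have h2 : (2 : ℝ) ^ X σ = Real.exp (X σ * Real.log 2) := by
      rw [Real.exp_nat_mul, Real.exp_log two_pos]
    rw [h2]
    have := Real.log_nonneg one_le_two
    gcongr
  have hf : (0 : ℝ) < n.factorial := by exact_mod_cast n.factorial_pos
  rw [permProb, hset, div_le_iff₀ hf, Real.exp_neg, ← div_eq_mul_inv, div_mul_eq_mul_div,
    le_div_iff₀ (Real.exp_pos _)]
  linarith

/-- There is an absolute constant `N₀` such that for all integers
`2 ≤ k ≤ s` and positive `n, n_R` with `k²·n = 625·s²·n_R`, `n_L = n − n_R` and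
`n ≥ N₀·r⁴` (where `r = s/k`), the probability over a uniformly random maximal chain `Z`
in `{0,1}^n` that `|V(Z)| ≥ √n/(500·r²)` is at most `exp(−√n/(90000·r²))`. -/
theorem stmt3 :
    ∃ N₀ : ℕ,
      ∀ (k s n nR nL : ℕ), 2 ≤ k → k ≤ s → 0 < n → 0 < nR →
        k ^ 2 * n = 625 * s ^ 2 * nR → nL = n - nR →
        ((N₀ : ℝ) * ((s : ℝ) / k) ^ 4 ≤ (n : ℝ)) →
        permProb n (fun σ =>
            Real.sqrt n / (500 * ((s : ℝ) / k) ^ 2) ≤ ((VSet nL (chainOf σ)).ncard : ℝ)) ≤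
          Real.exp (-(Real.sqrt n) / (90000 * ((s : ℝ) / k) ^ 2)) := by
  classical
  refine ⟨10 ^ 6, fun k s n nR nL hk hks hn hnR hkn hnL hN => ?_⟩
  have hk0 : (0 : ℝ) < k := by exact_mod_cast (by omega : 0 < k)
  set R : ℝ := ((s : ℝ) / k) ^ 2 with hR
  have hR1 : 1 ≤ R := by
    refine one_le_pow₀ ?_
    rw [one_le_div hk0]
    exact_mod_cast hks
  have hnR' : (0 : ℝ) < nR := by exact_mod_cast hnR
  have hn_eq : (n : ℝ) = 625 * R * nR := by
    have : (k : ℝ) ^ 2 * n = 625 * s ^ 2 * nR := by exact_mod_cast hkn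
    rw [hR]
    field_simp
    linarith
  have hle : nR ≤ n := by
    have : (nR : ℝ) ≤ n := by rw [hn_eq]; nlinarith
    exact_mod_cast this
  have hnL_eq : (nL : ℝ) = n - nR := by rw [hnL, Nat.cast_sub hle]
  have hnL_ge : 624 * R * nR ≤ nL := by rw [hnL_eq, hn_eq]; nlinarith
  have hnL1 : (1 : ℝ) ≤ nL := by
    have : (1 : ℝ) ≤ nR := by exact_mod_cast hnR
    nlinarith
  have hsqrt : 1000 * R ≤ Real.sqrt n := by
    refine Real.le_sqrt_of_sq_le (le_trans (le_of_eq ?_) hN)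
    rw [hR]
    push_cast
    ring
  set C : ℝ := 1 / (1 - 1 / (208 * R)) with hC
  have hu0 : 0 < 1 / (208 * R) := by positivity
  have hu1 : 1 / (208 * R) ≤ 1 / 208 := by
    apply one_div_le_one_div_of_le <;> linarith
  have hC1 : 1 ≤ C := by
    rw [hC, one_le_div (by linarith)]
    linarith
  have hCexp : C ≤ Real.exp (1 / (207 * R)) := by
    have h : C ≤ 1 / (207 * R) + 1 := by
      have h1 : 0 < 208 * R - 1 := by linarith
      have h2 : C = 1 / (208 * R - 1) + 1 := by
        rw [hC]
        field_simp
        ring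
      rw [h2]
      gcongr
      linarith
    exact h.trans (Real.add_one_le_exp _)
  have hmid : ∀ i, midL nL i → (nR : ℝ) ≤ ((nL : ℝ) - i) * (1 - 1 / C) := by
    intro i hi
    have h1 := (abs_le.1 hi).2
    have h2 : Real.sqrt nL ≤ nL := by
      rw [Real.sqrt_le_left (by linarith)]
      nlinarith
    have h3 : 208 * R * nR ≤ (nL : ℝ) - i := by linarith
    have h4 : 1 - 1 / C = 1 / (208 * R) := by rw [hC, one_div_one_div]; ring
    rw [h4, mul_one_div, le_div_iff₀ (by positivity)]
    linarith
  have hconv : ∀ a b x, midL nL a → midL nL b → a ≤ x → x ≤ b → midL nL x := by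
    intro a b x ha hb hax hxb
    have h1 : (a : ℝ) ≤ x := by exact_mod_cast hax
    have h2 : (x : ℝ) ≤ b := by exact_mod_cast hxb
    exact abs_le.2 ⟨by linarith [(abs_le.1 ha).1], by linarith [(abs_le.1 hb).2]⟩
  set c : Fin n → Bool := fun q => decide ((q : ℕ) < nL) with hc
  have hcL : (Finset.univ.filter (fun x => c x = true)).card = nL := by
    simp only [hc, decide_eq_true_eq]
    rw [Fin.card_filter_val_lt]
    omega
  have hcR : (Finset.univ.filter (fun x => c x = false)).card ≤ nR := by
    have := Finset.card_filter_add_card_filter_not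
      (s := (Finset.univ : Finset (Fin n))) (fun x => c x = true)
    simp only [Bool.not_eq_true, hcL, Finset.card_univ, Fintype.card_fin] at this
    omega
  have hsum := sum_two_pow_windowCount_le (midL nL) nL nR C hC1 hmid n 0 c (by omega) hcR
  have hV : ∀ σ : Equiv.Perm (Fin n), (VSet nL (chainOf σ)).ncard ≤
      windowCount (midL nL) 0 (fun x => c (σ x)) + 1 := by
    intro σ
    have := ncard_countBelow_le (midL nL) hconv (fun x => c (σ x))
    simpa only [VSet, wL_chainOf, wR_chainOf] using this
  refine (permProb_le_of_sum_two_pow_le _ _ (Real.sqrt n / (500 * R) - 1) _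
    (fun σ hσ => ?_) hsum).trans ?_
  · have : ((VSet nL (chainOf σ)).ncard : ℝ) ≤
        (windowCount (midL nL) 0 (fun x => c (σ x)) : ℝ) + 1 := by exact_mod_cast hV σ
    linarith
  set M := ((Finset.Ico 0 (nL + 1)).filter (midL nL)).card with hM
  have hprod : ∏ i ∈ Finset.Ico 0 (nL + 1), (if midL nL i then C else 1) = C ^ M := by
    rw [Finset.prod_ite]
    simp [hM]
  have hMle : (M : ℝ) ≤ Real.sqrt n / 50 + 1 := by
    refine (card_filter_midL_le nL _).trans ?_
    gcongr
    omega
  have hCM : C ^ M ≤ Real.exp ((Real.sqrt n / 50 + 1) * (1 / (207 * R))) :=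
    calc C ^ M ≤ Real.exp (1 / (207 * R)) ^ M := by gcongr
      _ = Real.exp (M * (1 / (207 * R))) := (Real.exp_nat_mul _ _).symm
      _ ≤ _ := by gcongr
  rw [hprod]
  refine (mul_le_mul_of_nonneg_right hCM (Real.exp_pos _).le).trans ?_
  rw [← Real.exp_add, Real.exp_le_exp]
  set S := Real.sqrt n / R with hS
  have hS1 : 1000 ≤ S := by rwa [hS, le_div_iff₀ (by linarith)]
  have e1 : Real.sqrt n / (500 * R) = S / 500 := by rw [hS]; field_simp
  have e2 : -Real.sqrt n / (90000 * R) = -(S / 90000) := by rw [hS]; field_simp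
  have e3 : (Real.sqrt n / 50 + 1) * (1 / (207 * R)) ≤ S / 10350 + 1 / 207 := by
    have h1 : (Real.sqrt n / 50 + 1) * (1 / (207 * R)) = S / 10350 + 1 / (207 * R) := by
      rw [hS]
      field_simp
      ring
    have h2 : 1 / (207 * R) ≤ 1 / 207 := by
      apply one_div_le_one_div_of_le <;> linarith
    linarith
  rw [e1, e2]
  have hl1 := Real.log_two_gt_d9
  have hl2 : (S / 500 - 1) * 0.69 ≤ (S / 500 - 1) * Real.log 2 := by
    apply mul_le_mul_of_nonneg_left <;> linarith
  linarith
end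

section
/- Let k ≥ 2 be an even integer and s an integer with s ≥ k, let n, n_R be positive integers with k²·n = 625·s²·n_R, n_L = n − n_R, and 12·s ≤ √n_R, and let f be the hard function built from any balanced-blocks function on (Fin n_R → Bool) with 3s blocks. Then for every maximal chain Z in {0,1}^n: if Z contains a violation of k-monotonicity of f, then |V(Z)| ≥ k·√n_R/(16·s). -/
theorem mul_centralBinom_sq_le (j : ℕ) : (2 * j + 1) * j.centralBinom ^ 2 ≤ 16 ^ j := by
  induction j with
  | zero => simp
  | succ j ih =>
    have h := Nat.succ_mul_centralBinom_succ j
    have hpos : 0 < (j + 1) ^ 2 := by positivity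
    refine Nat.le_of_mul_le_mul_left ?_ hpos
    calc (j + 1) ^ 2 * ((2 * (j + 1) + 1) * (j + 1).centralBinom ^ 2)
        = (2 * j + 3) * ((j + 1) * (j + 1).centralBinom) ^ 2 := by ring
      _ = 4 * ((2 * j + 3) * (2 * j + 1)) * ((2 * j + 1) * j.centralBinom ^ 2) := by
        rw [h]; ring
      _ ≤ 4 * (4 * (j + 1) ^ 2) * 16 ^ j := by
        refine Nat.mul_le_mul (Nat.mul_le_mul_left 4 ?_) ih
        nlinarith
      _ = (j + 1) ^ 2 * 16 ^ (j + 1) := by ring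

theorem mul_choose_sq_le (m r : ℕ) : m * m.choose r ^ 2 ≤ 4 ^ m := by
  obtain ⟨j, rfl | rfl⟩ := Nat.even_or_odd' m
  · calc 2 * j * (2 * j).choose r ^ 2 ≤ (2 * j + 1) * j.centralBinom ^ 2 := by
          gcongr
          · omega
          · exact Nat.choose_le_centralBinom r j
      _ ≤ 16 ^ j := mul_centralBinom_sq_le j
      _ = 4 ^ (2 * j) := by rw [pow_mul]; norm_num
  · have h : (2 * j + 1).choose r ≤ 2 * j.centralBinom := by
      cases r with
      | zero =>
        have := Nat.centralBinom_pos j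
        simp only [Nat.choose_zero_right]
        omega
      | succ r =>
        rw [Nat.choose_succ_succ]
        have h1 := Nat.choose_le_centralBinom r j
        have h2 := Nat.choose_le_centralBinom (r + 1) j
        simp only [Nat.succ_eq_add_one]
        omega
    calc (2 * j + 1) * (2 * j + 1).choose r ^ 2
        ≤ (2 * j + 1) * (2 * j.centralBinom) ^ 2 := by gcongr
      _ = 4 * ((2 * j + 1) * j.centralBinom ^ 2) := by ring
      _ ≤ 4 * 16 ^ j := by gcongr; exact mul_centralBinom_sq_le j
      _ = 4 ^ (2 * j + 1) := by rw [pow_succ, pow_mul]; norm_num [mul_comm]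

theorem choose_mul_sqrt_le (m r : ℕ) : (m.choose r : ℝ) * Real.sqrt m ≤ 2 ^ m := by
  refine le_of_sq_le_sq ?_ (by positivity)
  rw [mul_pow, Real.sq_sqrt (Nat.cast_nonneg m), ← pow_mul, mul_comm m 2, pow_mul]
  have h : ((m * m.choose r ^ 2 : ℕ) : ℝ) ≤ ((4 ^ m : ℕ) : ℝ) :=
    Nat.cast_le.2 (mul_choose_sq_le m r)
  push_cast at h
  norm_num
  linarith

theorem card_wt_eq_le (m w : ℕ) :
    (Finset.univ.filter (fun y : Pt m => wt y = w)).card ≤ m.choose w := by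
  have hc : (Finset.powersetCard w (Finset.univ : Finset (Fin m))).card = m.choose w := by
    simp
  rw [← hc]
  refine Finset.card_le_card_of_injOn
    (fun y => Finset.univ.filter (fun i => y i = true)) ?_ ?_
  · intro y hy
    rw [Finset.mem_coe, Finset.mem_filter] at hy
    rw [Finset.mem_coe, Finset.mem_powersetCard]
    exact ⟨Finset.subset_univ _, hy.2⟩
  · intro y _ z _ h
    funext i
    have hi := congrArg (fun t => i ∈ t) h
    simp only [Finset.mem_filter, Finset.mem_univ, true_and, eq_iff_iff] at hi
    exact Bool.eq_iff_iff.2 hi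

theorem ncard_wt_Ico_le (m a c : ℕ) :
    {y : Pt m | a ≤ wt y ∧ wt y < c}.ncard ≤ (c - a) * m.choose (m / 2) := by
  have hset : {y : Pt m | a ≤ wt y ∧ wt y < c} =
      ↑(Finset.univ.filter (fun y : Pt m => a ≤ wt y ∧ wt y < c)) := by
    ext y; simp
  rw [hset, Set.ncard_coe_finset, mul_comm, ← Nat.card_Ico]
  refine Finset.card_le_mul_card_image_of_maps_to (f := wt) ?_ _ ?_
  · intro y hy
    simpa using hy
  · intro w _
    refine (Finset.card_le_card ?_).trans ((card_wt_eq_le m w).trans (Nat.choose_le_middle w m))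
    intro y hy
    simp only [Finset.mem_filter, Finset.mem_univ, true_and] at hy ⊢
    exact hy.2

theorem IsBBPartition.width_ge {m s : ℕ} {b : ℕ → ℕ} (hb : IsBBPartition m (3 * s) b)
    (hs : 0 < s) (hsm : (12 : ℝ) * s ≤ Real.sqrt m) {i : ℕ} (hi : i < 3 * s) :
    Real.sqrt m / (4 * s) ≤ (b (i + 1) : ℝ) - b i := by
  obtain ⟨-, -, hlt, hcard⟩ := hb
  have hs' : (0 : ℝ) < s := by exact_mod_cast hs
  have hm : 0 < Real.sqrt m := by linarith
  have hle : b i ≤ b (i + 1) := (hlt i hi).le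
  have h1 := (hcard i hi).1
  have h2 : ({y : Pt m | b i ≤ wt y ∧ wt y < b (i + 1)}.ncard : ℝ) ≤
      ((b (i + 1) : ℝ) - b i) * m.choose (m / 2) := by
    have := ncard_wt_Ico_le m (b i) (b (i + 1))
    rw [← Nat.cast_sub hle]
    exact_mod_cast this
  have h3 := choose_mul_sqrt_le m (m / 2)
  have hw : (0 : ℝ) ≤ (b (i + 1) : ℝ) - b i := by
    rw [sub_nonneg]; exact_mod_cast hle
  have hfrac : ((3 * s : ℕ) : ℝ) / Real.sqrt m ≤ 1 / 4 := by
    rw [div_le_iff₀ hm]; push_cast; linarith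
  have h4 : (2 : ℝ) ^ m / (4 * s) ≤ (1 - ((3 * s : ℕ) : ℝ) / Real.sqrt m) * 2 ^ m / (3 * s : ℕ) := by
    calc (2 : ℝ) ^ m / (4 * s) = (3 / 4) * 2 ^ m / (3 * s : ℕ) := by
          push_cast; field_simp
      _ ≤ _ := by gcongr; linarith
  have h5 := mul_le_mul_of_nonneg_right ((h4.trans h1).trans h2) hm.le
  have h6 := mul_le_mul_of_nonneg_left h3 hw
  have hp : (0 : ℝ) < 2 ^ m := by positivity
  refine le_of_mul_le_mul_right ?_ hp
  calc Real.sqrt m / (4 * s) * 2 ^ m = 2 ^ m / (4 * s) * Real.sqrt m := by ring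
    _ ≤ _ := h5
    _ = ((b (i + 1) : ℝ) - b i) * (m.choose (m / 2) * Real.sqrt m) := by ring
    _ ≤ _ := h6

theorem mul_le_sub_of_forall_step {b : ℕ → ℕ} {l : ℕ} {q : ℝ}
    (h : ∀ i < l, q ≤ (b (i + 1) : ℝ) - b i) (i d : ℕ) (hd : i + d ≤ l) :
    d * q ≤ (b (i + d) : ℝ) - b i := by
  induction d with
  | zero => simp
  | succ d ih =>
    have h1 := ih (by omega)
    have h2 := h (i + d) (by omega)
    rw [← add_assoc]
    push_cast
    linarith

theorem exists_block {b : ℕ → ℕ} (l w : ℕ) (h0 : b 0 ≤ w) (hl : w < b l) :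
    ∃ i < l, b i ≤ w ∧ w < b (i + 1) := by
  induction l with
  | zero => omega
  | succ l ih =>
    by_cases h : w < b l
    · obtain ⟨i, hi, hw⟩ := ih h
      exact ⟨i, by omega, hw⟩
    · exact ⟨l, by omega, by omega, hl⟩

theorem le_of_forall_lt_succ {b : ℕ → ℕ} {l : ℕ} (h : ∀ i < l, b i < b (i + 1))
    {i j : ℕ} (hij : i ≤ j) (hj : j ≤ l) : b i ≤ b j := by
  induction j, hij using Nat.le_induction with
  | base => exact le_rfl
  | succ j _ ih => exact (ih (by omega)).trans (h j (by omega)).le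

theorem block_index_le {b : ℕ → ℕ} {l : ℕ} (h : ∀ i < l, b i < b (i + 1))
    {i j u v : ℕ} (hi : i < l) (hu : b i ≤ u) (hv : v < b (j + 1))
    (huv : u ≤ v) : i ≤ j := by
  by_contra hij
  have := le_of_forall_lt_succ h (show j + 1 ≤ i by omega) hi.le
  omega

theorem IsBBFun.eq_true_iff_even {m l : ℕ} {b : ℕ → ℕ} {BB : Pt m → Bool}
    (hBB : IsBBFun m l b BB) (h : ∀ i < l, b i < b (i + 1)) {y : Pt m} {i : ℕ} (hi : i < l)
    (h1 : b i ≤ wt y) (h2 : wt y < b (i + 1)) : BB y = true ↔ Even i := by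
  rw [hBB y]
  constructor
  · rintro ⟨j, hj, he, hj1, hj2⟩
    have e1 := block_index_le h hi h1 hj2 le_rfl
    have e2 := block_index_le h hj hj1 h2 le_rfl
    rwa [le_antisymm e1 e2]
  · exact fun he => ⟨i, hi, he, h1, h2⟩

theorem exists_eq_of_step_le_one {g : ℕ → ℕ} {a c : ℕ} (hac : a ≤ c)
    (h : ∀ i, a ≤ i → i < c → g (i + 1) ≤ g i + 1) {j : ℕ} (h1 : g a ≤ j) (h2 : j ≤ g c) :
    ∃ i, a ≤ i ∧ i ≤ c ∧ g i = j := by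
  induction c, hac using Nat.le_induction with
  | base => exact ⟨a, le_rfl, le_rfl, by omega⟩
  | succ c hac ih =>
    by_cases hj : j ≤ g c
    · obtain ⟨i, hi1, hi2, hi3⟩ := ih (fun i h1 h2 => h i h1 (by omega)) hj
      exact ⟨i, hi1, by omega, hi3⟩
    · have := h c hac (by omega)
      exact ⟨c + 1, by omega, le_rfl, by omega⟩

theorem wL_add_wR {n : ℕ} (nL : ℕ) (z : Pt n) : wL nL z + wR nL z = wt z := by
  unfold wL wR wt
  rw [← Finset.card_union_of_disjoint]
  · congr 1
    ext i
    simp only [Finset.mem_union, Finset.mem_filter, Finset.mem_univ, true_and]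
    have := lt_or_ge (i : ℕ) nL
    tauto
  · rw [Finset.disjoint_left]
    intro i h1 h2
    simp only [Finset.mem_filter, Finset.mem_univ, true_and] at h1 h2
    omega

theorem wL_mono {n : ℕ} (nL : ℕ) {x y : Pt n} (h : ple x y) : wL nL x ≤ wL nL y := by
  refine Finset.card_le_card fun i hi => ?_
  simp only [Finset.mem_filter, Finset.mem_univ, true_and] at hi ⊢
  exact ⟨hi.1, Bool.le_iff_imp.1 (h i) hi.2⟩

theorem wR_mono {n : ℕ} (nL : ℕ) {x y : Pt n} (h : ple x y) : wR nL x ≤ wR nL y := by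
  refine Finset.card_le_card fun i hi => ?_
  simp only [Finset.mem_filter, Finset.mem_univ, true_and] at hi ⊢
  exact ⟨hi.1, Bool.le_iff_imp.1 (h i) hi.2⟩

theorem wt_yPart {n nL nR : ℕ} (h : nL + nR = n) (z : Pt n) :
    wt (yPart nL nR h z) = wR nL z := by
  unfold wt wR
  refine Finset.card_bij (fun j _ => ⟨nL + (j : ℕ), by have := j.isLt; omega⟩) ?_ ?_ ?_
  · intro j hj
    simp only [Finset.mem_filter, Finset.mem_univ, true_and] at hj ⊢
    exact ⟨by simp, hj⟩
  · intro j _ j' _ hjj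
    simp only [Fin.mk.injEq] at hjj
    exact Fin.ext (by omega)
  · intro i hi
    simp only [Finset.mem_filter, Finset.mem_univ, true_and] at hi
    have hlt := i.isLt
    have hi' : (⟨nL + ((i : ℕ) - nL), by omega⟩ : Fin n) = i := Fin.ext (by simp; omega)
    refine ⟨⟨(i : ℕ) - nL, by omega⟩, ?_, hi'⟩
    rw [Finset.mem_filter]
    exact ⟨Finset.mem_univ _, (congrArg z hi').trans hi.2⟩

theorem IsFullChain.ple {n : ℕ} {Z : ℕ → Pt n} (hZ : IsFullChain Z) {i j : ℕ}
    (hij : i ≤ j) (hj : j ≤ n) : ple (Z i) (Z j) := by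
  induction j, hij using Nat.le_induction with
  | base => exact fun _ => le_rfl
  | succ j _ ih => exact fun c => (ih (by omega) c).trans ((hZ.1 j (by omega)).1 c)

theorem midL_of_between {nL u v w : ℕ} (hu : midL nL u) (hv : midL nL v) (huw : u ≤ w)
    (hwv : w ≤ v) : midL nL w := by
  unfold midL at *
  rw [abs_le] at *
  have h1 : (u : ℝ) ≤ w := by exact_mod_cast huw
  have h2 : (w : ℝ) ≤ v := by exact_mod_cast hwv
  constructor <;> linarith

theorem Icc_subset_VSet {n nL : ℕ} {Z : ℕ → Pt n} (hZ : IsFullChain Z) {a c : ℕ}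
    (hac : a ≤ c) (hc : c ≤ n) (ha : midL nL (wL nL (Z a))) (hc' : midL nL (wL nL (Z c))) :
    Set.Icc (wR nL (Z a)) (wR nL (Z c)) ⊆ VSet nL Z := by
  intro j hj
  obtain ⟨i, h1, h2, h3⟩ := exists_eq_of_step_le_one (g := fun i => wR nL (Z i)) hac
    (fun i _ hi => by
      have e1 := wL_add_wR nL (Z i)
      have e2 := wL_add_wR nL (Z (i + 1))
      have e3 := hZ.2 i (by omega)
      have e4 := hZ.2 (i + 1) (by omega)
      have e5 := wL_mono nL (hZ.1 i (by omega)).1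
      show wR nL (Z (i + 1)) ≤ wR nL (Z i) + 1
      omega) hj.1 hj.2
  exact ⟨i, h2.trans hc, midL_of_between ha hc' (wL_mono nL (hZ.ple h1 (h2.trans hc)))
    (wL_mono nL (hZ.ple h2 hc)), h3⟩

theorem VSet_finite {n : ℕ} (nL : ℕ) (Z : ℕ → Pt n) : (VSet nL Z).Finite := by
  refine ((Set.finite_Iic n).image (fun i => wR nL (Z i))).subset ?_
  rintro j ⟨i, hi, -, rfl⟩
  exact ⟨i, hi, rfl⟩

/-- Let `k ≥ 2` be even, `s ≥ k`, and `n, n_R` positive with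
`k²·n = 625·s²·n_R`, `n_L = n − n_R` and `12·s ≤ √n_R`; let `f` be the hard function built
from any balanced-blocks function on `{0,1}^{n_R}` with `3s` blocks. Then every maximal
chain `Z` of `{0,1}^n` containing a violation of `k`-monotonicity of `f` satisfies
`|V(Z)| ≥ k·√n_R/(16·s)`. -/
theorem stmt4 (k s n nR nL : ℕ) (hk2 : 2 ≤ k) (hkeven : Even k) (hks : k ≤ s)
    (hn : 0 < n) (hnR : 0 < nR) (heq : k ^ 2 * n = 625 * s ^ 2 * nR)
    (hnL : nL = n - nR) (hsum : nL + nR = n)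
    (hsR : (12 : ℝ) * s ≤ Real.sqrt nR)
    (b : ℕ → ℕ) (BB : Pt nR → Bool)
    (hb : IsBBPartition nR (3 * s) b) (hBB : IsBBFun nR (3 * s) b BB)
    (f : Pt n → Bool) (hf : IsHardFun nL nR hsum BB f)
    (Z : ℕ → Pt n) (hZ : IsFullChain Z) (hviol : ChainViol k f Z) :
    (k : ℝ) * Real.sqrt nR / (16 * s) ≤ ((VSet nL Z).ncard : ℝ) := by
  have hs : 0 < s := by omega
  have hs' : (0 : ℝ) < s := by exact_mod_cast hs
  have hlt := hb.2.2.1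
  obtain ⟨t, ht, htn, hf0, halt⟩ := hviol
  have htmono : ∀ i j, i ≤ j → j ≤ k → t i ≤ t j := fun i j hij hj =>
    le_of_forall_lt_succ ht hij hj
  have hfk : ∀ i ≤ k, f (Z (t i)) = decide (Even i) := by
    intro i hi
    induction i with
    | zero => simpa using hf0
    | succ i ih =>
      have h1 := halt i (by omega)
      rw [ih (by omega)] at h1
      by_cases he : Even i
      · have h2 : ¬ Even (i + 1) := by simpa [Nat.even_add_one] using he
        simpa [he, h2] using h1.symm
      · have h2 : Even (i + 1) := by simpa [Nat.even_add_one] using he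
        simpa [he, h2] using h1.symm
  have hmid_of_true : ∀ z, f z = true → midL nL (wL nL z) := by
    intro z hz
    by_contra h
    have := (hf z).2 h
    simp [this] at hz
  have hmid0 : midL nL (wL nL (Z (t 0))) := hmid_of_true _ hf0
  have hmidk : midL nL (wL nL (Z (t k))) :=
    hmid_of_true _ (by rw [hfk k le_rfl]; simpa using hkeven)
  have hmid : ∀ i ≤ k, midL nL (wL nL (Z (t i))) := fun i hi =>
    midL_of_between hmid0 hmidk
      (wL_mono nL (hZ.ple (htmono 0 i (Nat.zero_le i) hi) (htn i hi)))
      (wL_mono nL (hZ.ple (htmono i k hi le_rfl) (htn k le_rfl)))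
  have hblock : ∀ i, ∃ p < 3 * s, b p ≤ wR nL (Z (t i)) ∧ wR nL (Z (t i)) < b (p + 1) := by
    intro i
    refine exists_block (3 * s) _ (by rw [hb.1]; exact Nat.zero_le _) ?_
    rw [hb.2.1, ← wt_yPart hsum]
    have : wt (yPart nL nR hsum (Z (t i))) ≤ nR := by
      simpa [wt] using Finset.card_le_univ
        (Finset.univ.filter (fun j => yPart nL nR hsum (Z (t i)) j = true))
    omega
  choose p hpl hp1 hp2 using hblock
  have hparity : ∀ i ≤ k, f (Z (t i)) = true ↔ Even (p i) := by
    intro i hi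
    rw [(hf (Z (t i))).1 (hmid i hi)]
    exact hBB.eq_true_iff_even hlt (hpl i) (by rw [wt_yPart]; exact hp1 i)
      (by rw [wt_yPart]; exact hp2 i)
  have hpstep : ∀ i < k, p i < p (i + 1) := by
    intro i hi
    have hle : p i ≤ p (i + 1) := block_index_le hlt (hpl i) (hp1 i) (hp2 (i + 1))
      (wR_mono nL (hZ.ple (ht i hi).le (htn (i + 1) hi)))
    refine lt_of_le_of_ne hle fun he => halt i hi ?_
    rw [Bool.eq_iff_iff, hparity i hi.le, hparity (i + 1) hi, he]
  have hpk : ∀ i ≤ k, p 0 + i ≤ p i := by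
    intro i hi
    induction i with
    | zero => simp
    | succ i ih =>
      have h1 := ih (by omega)
      have h2 := hpstep i (by omega)
      omega
  have hpk' := hpk k le_rfl
  have hplk := hpl k
  have hwidth := mul_le_sub_of_forall_step
    (fun i (hi : i < 3 * s) => hb.width_ge hs hsR hi) (p 0 + 1) (k - 1) (by omega)
  have hbk : b (p 0 + 1 + (k - 1)) ≤ wR nL (Z (t k)) :=
    (le_of_forall_lt_succ hlt (by omega) hplk.le).trans (hp1 k)
  have hb0 : wR nL (Z (t 0)) < b (p 0 + 1) := hp2 0
  have hcard : wR nL (Z (t k)) + 1 - wR nL (Z (t 0)) ≤ (VSet nL Z).ncard := by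
    have h := Set.ncard_le_ncard
      (Icc_subset_VSet hZ (htmono 0 k (Nat.zero_le k) le_rfl) (htn k le_rfl) hmid0 hmidk)
      (VSet_finite nL Z)
    rwa [← Finset.coe_Icc, Set.ncard_coe_finset, Nat.card_Icc] at h
  have hcard' : (b (p 0 + 1 + (k - 1)) : ℝ) ≤ (VSet nL Z).ncard + b (p 0 + 1) := by
    exact_mod_cast (by omega :
      b (p 0 + 1 + (k - 1)) ≤ (VSet nL Z).ncard + b (p 0 + 1))
  have hk : (k : ℝ) / 4 ≤ ((k - 1 : ℕ) : ℝ) := by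
    rw [Nat.cast_sub (by omega)]
    have : (2 : ℝ) ≤ k := by exact_mod_cast hk2
    push_cast
    linarith
  calc (k : ℝ) * Real.sqrt nR / (16 * s) = k / 4 * (Real.sqrt nR / (4 * s)) := by
        field_simp; norm_num
    _ ≤ ((k - 1 : ℕ) : ℝ) * (Real.sqrt nR / (4 * s)) := by gcongr
    _ ≤ _ := by linarith
end
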